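/- Let m ≥ 1, let μ be the uniform probability measure on the cube (−1/2, 1/2]^m ⊆ ℝ^m, and let y ∈ ℝ^m. Let K : ℝ^m → ℝ^m apply round coordinatewise, K(v)_i = round(v_i). Then the pushforward of μ under u ↦ K(y + u) − u equals the pushforward of μ under u ↦ y − u. -/

import Mathlib

open MeasureTheory

theorem measurable_round_add_sub (y : ℝ) :
    Measurable fun u : ℝ => ((round (y + u) : ℤ) : ℝ) - u := by
  simp only [round_eq]
  fun_prop

/-- The one-dimensional Crypto-Lemma: `u ↦ round (y + u) - u` and `u ↦ y - u` push the uniform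
measure on `(-1/2, 1/2]` to the same measure. -/
theorem map_round_add_sub_restrict_Ioc (y : ℝ) :
    Measure.map (fun u : ℝ => ((round (y + u) : ℤ) : ℝ) - u)
      (volume.restrict (Set.Ioc (-(1/2) : ℝ) (1/2))) =
    Measure.map (fun u : ℝ => y - u) (volume.restrict (Set.Ioc (-(1/2) : ℝ) (1/2))) := by
  have hg := measurable_round_add_sub y
  have hsub : Measurable fun u : ℝ => y - u := by fun_prop
  ext A hA
  rw [Measure.map_apply hg hA, Measure.map_apply hsub hA,
    Measure.restrict_apply (hg hA), Measure.restrict_apply (hsub hA)]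
  set B : Set ℝ := (fun u : ℝ => ((round (y + u) : ℤ) : ℝ) - u) ⁻¹' A with hB
  have hper : ∀ g : AddSubgroup.zmultiples (1 : ℝ), (fun x : ℝ => g +ᵥ x) ⁻¹' B = B := by
    rintro ⟨_, n, rfl⟩
    ext x
    have hx : y + ((n : ℝ) + x) = y + x + (n : ℤ) := by ring
    simp only [hB, Set.mem_preimage, AddSubgroup.vadd_def, vadd_eq_add, zsmul_eq_mul, mul_one, hx,
      round_add_intCast, Int.cast_add]
    ring_nf
  have hshift := (isAddFundamentalDomain_Ioc one_pos (-(1/2) : ℝ)).measure_set_eq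
    (isAddFundamentalDomain_Ioc one_pos (-y - 1/2)) (hg hA) hper
  have hneg : B ∩ Set.Ico (-y - 1/2) (-y - 1/2 + 1) =
      (fun u : ℝ => -u) ⁻¹' A ∩ Set.Ico (-y - 1/2) (-y - 1/2 + 1) := by
    ext x
    refine and_congr_left fun hx => ?_
    have : round (y + x) = 0 :=
      round_eq_zero_iff.2 ⟨by linarith [hx.1], by linarith [hx.2]⟩
    simp [hB, this]
  have htrans : (fun u : ℝ => y - u) ⁻¹' A ∩ Set.Ioc (-(1/2)) (1/2) =
      (fun u : ℝ => u + -y) ⁻¹' ((fun u : ℝ => -u) ⁻¹' A ∩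
        Set.Ioc (-y - 1/2) (-y - 1/2 + 1)) := by
    ext x
    simp only [Set.mem_inter_iff, Set.mem_preimage, Set.mem_Ioc]
    rw [show -(x + -y) = y - x by ring]
    refine and_congr_right fun _ => ⟨fun h => ⟨?_, ?_⟩, fun h => ⟨?_, ?_⟩⟩ <;> linarith [h.1, h.2]
  have hend : ∀ C : Set ℝ, volume (C ∩ Set.Ico (-y - 1/2) (-y - 1/2 + 1)) =
      volume (C ∩ Set.Ioc (-y - 1/2) (-y - 1/2 + 1)) := fun C =>
    measure_congr (Filter.EventuallyEq.rfl.inter Ico_ae_eq_Ioc)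
  rw [show -(1/2 : ℝ) + 1 = 1/2 by norm_num] at hshift
  rw [htrans, measure_preimage_add_right, ← hend, ← hneg, hend, hshift]

/-- **Crypto-Lemma for the lattice ℤ^m.**
Let `μ` be the uniform probability measure on the cube `(-1/2, 1/2]^m ⊆ ℝ^m` and let `y ∈ ℝ^m`.
With `K` the coordinatewise rounding map, the pushforward of `μ` under `u ↦ K (y + u) - u`
equals the pushforward of `μ` under `u ↦ y - u`. -/
theorem crypto_lemma_Zm (m : ℕ) (hm : 1 ≤ m) (y : Fin m → ℝ) :
    Measure.map (fun u : Fin m → ℝ => (fun i => ((round (y i + u i) : ℤ) : ℝ)) - u)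
      (volume.restrict (Set.univ.pi fun _ : Fin m => Set.Ioc (-(1/2) : ℝ) (1/2))) =
    Measure.map (fun u : Fin m → ℝ => y - u)
      (volume.restrict (Set.univ.pi fun _ : Fin m => Set.Ioc (-(1/2) : ℝ) (1/2))) := by
  have hround := fun i => (measurable_round_add_sub (y i)).aemeasurable
    (μ := volume.restrict (Set.Ioc (-(1/2) : ℝ) (1/2)))
  have hsub : ∀ i, AEMeasurable (fun u : ℝ => y i - u)
      (volume.restrict (Set.Ioc (-(1/2) : ℝ) (1/2))) := fun i => by fun_prop
  rw [volume_pi, Measure.restrict_pi_pi]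
  refine (Measure.pi_map_pi hround).trans (Eq.trans ?_ (Measure.pi_map_pi hsub).symm)
  simp only [map_round_add_sub_restrict_Ioc]
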